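/- arXiv:2002.01258 — 3 statements merged into one kernel-verified Lean document; each statement's English description precedes it below -/
import Mathlib

section
/- Let κ, C > 0 and r ∈ (0,1) be given constants. Then there exist c > 0 and ε₀ > 0 such that for all ε ∈ (0, ε₀), setting γ = 1 + rε, q_1 = 1 - ε + κε², and q_k = (Cε)^{k-1}/k! for k ≥ 2, one has for all x > c: Σ_{k ≥ 1} Σ_{ℓ ≥ 1} q_k q_ℓ · min( 1, falling((k ∨ ℓ), (k ∧ ℓ)) · F(k ∧ ℓ, γx - (k ∧ ℓ)c) ) ≤ exp(-(x - c)), where falling(m, p) := m!/(m-p)! is the falling factorial, k ∨ ℓ = max(k,ℓ), k ∧ ℓ = min(k,ℓ), and F(m, y) := 1 if y < 0 and F(m, y) := e^{-y} Σ_{j=0}^{m-1} y^j/j! if y ≥ 0 (the probability that a sum of m independent rate-1 exponential random variables exceeds y). -/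
open Real
open scoped Classical

namespace Paper

/-- `F(m,y)`: the upper tail at `y` of the sum of `m` independent rate-1 exponential
random variables: `1` for `y < 0` and `e^{-y} Σ_{j<m} y^j/j!` for `y ≥ 0`. -/
noncomputable def gammaTail (m : ℕ) (y : ℝ) : ℝ :=
  if y < 0 then 1 else Real.exp (-y) * ∑ j ∈ Finset.range m, y ^ j / (Nat.factorial j)

/-- An iterated sum dominated termwise by a finite sum of product functions. -/
theorem tsum_tsum_le_sum_mul {ι : Type*} (I : Finset ι) {f : ℕ → ℕ → ℝ} {u v : ι → ℕ → ℝ}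
    {U V : ι → ℝ} (hf : ∀ k l, 0 ≤ f k l) (hfuv : ∀ k l, f k l ≤ ∑ i ∈ I, u i k * v i l)
    (hu : ∀ i ∈ I, HasSum (u i) (U i)) (hv : ∀ i ∈ I, HasSum (v i) (V i)) :
    ∑' k, ∑' l, f k l ≤ ∑ i ∈ I, U i * V i := by
  have hrow (k : ℕ) : HasSum (fun l => ∑ i ∈ I, u i k * v i l) (∑ i ∈ I, u i k * V i) :=
    hasSum_sum fun i hi => (hv i hi).mul_left _
  have htot : HasSum (fun k => ∑ i ∈ I, u i k * V i) (∑ i ∈ I, U i * V i) :=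
    hasSum_sum fun i hi => (hu i hi).mul_right _
  have hle (k : ℕ) : ∑' l, f k l ≤ ∑ i ∈ I, u i k * V i :=
    (hrow k).tsum_eq ▸ ((hrow k).summable.of_nonneg_of_le (hf k) (hfuv k)).tsum_le_tsum (hfuv k)
      (hrow k).summable
  exact htot.tsum_eq ▸ (htot.summable.of_nonneg_of_le
    (fun k => tsum_nonneg (hf k)) hle).tsum_le_tsum hle htot.summable

theorem hasSum_geometric_of_ne_zero {a : ℝ} (h0 : 0 ≤ a) (h1 : a < 1) :
    HasSum (fun k : ℕ => if k = 0 then 0 else a ^ k) (a / (1 - a)) := by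
  have h := ((hasSum_geometric_of_lt_one h0 h1).mul_left a)
  refine (hasSum_nat_add_iff' 1).mp ?_
  simpa [pow_succ', div_eq_mul_inv] using h

theorem gammaTail_nonneg (m : ℕ) (y : ℝ) : 0 ≤ gammaTail m y := by
  unfold gammaTail
  split_ifs with h
  · exact zero_le_one
  · have : 0 ≤ y := not_lt.mp h
    positivity

theorem gammaTail_one_le (y : ℝ) : gammaTail 1 y ≤ Real.exp (-y) := by
  unfold gammaTail
  split_ifs with h
  · exact Real.one_le_exp (by linarith)
  · simp

theorem gammaTail_succ_le {y R t : ℝ} (l : ℕ) (hR : 1 ≤ R) (ht : 0 ≤ t) (hy : y ≤ R * t) :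
    gammaTail (l + 1) y ≤ Real.exp (-y) * (1 + R ^ l * (Real.exp t - 1)) := by
  have het : 0 ≤ R ^ l * (Real.exp t - 1) :=
    mul_nonneg (by positivity) (by linarith [Real.one_le_exp ht])
  unfold gammaTail
  split_ifs with h
  · exact (Real.one_le_exp (by linarith)).trans
      (le_mul_of_one_le_right (Real.exp_pos _).le (by linarith))
  have hy0 : 0 ≤ y := not_lt.mp h
  refine mul_le_mul_of_nonneg_left ?_ (Real.exp_pos _).le
  have hexp := Real.sum_le_exp_of_nonneg ht (l + 1)
  rw [Finset.sum_range_succ'] at hexp ⊢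
  have hterm : ∑ j ∈ Finset.range l, y ^ (j + 1) / ((j + 1).factorial : ℝ) ≤
      R ^ l * ∑ j ∈ Finset.range l, t ^ (j + 1) / ((j + 1).factorial : ℝ) := by
    rw [Finset.mul_sum]
    refine Finset.sum_le_sum fun j hj => ?_
    rw [← mul_div_assoc]
    gcongr
    calc y ^ (j + 1) ≤ (R * t) ^ (j + 1) := by gcongr
      _ = R ^ (j + 1) * t ^ (j + 1) := mul_pow _ _ _
      _ ≤ R ^ l * t ^ (j + 1) := by
        gcongr
        exact Finset.mem_range.mp hj
  simp only [pow_zero, Nat.factorial_zero, Nat.cast_one, div_one] at hexp ⊢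
  have := mul_le_mul_of_nonneg_left (show ∑ j ∈ Finset.range l, t ^ (j + 1) /
    ((j + 1).factorial : ℝ) ≤ Real.exp t - 1 by linarith) (show 0 ≤ R ^ l by positivity)
  linarith

theorem mul_descFactorial_le {s p q : ℝ} {k l : ℕ} (hs : 0 ≤ s) (hq0 : 0 ≤ q)
    (hp : p ≤ s ^ k / (k + 1).factorial) (hq : q ≤ s ^ l / (l + 1).factorial) :
    p * q * ((k + 1).descFactorial (l + 1) : ℝ) ≤ s ^ k * s ^ l := by
  have hd : ((k + 1).descFactorial (l + 1) : ℝ) ≤ (k + 1).factorial := by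
    rcases lt_or_ge (k + 1) (l + 1) with h | h
    · rw [Nat.descFactorial_of_lt h]
      simp
    · rw [← Nat.factorial_mul_descFactorial h]
      exact_mod_cast Nat.le_mul_of_pos_left _ (Nat.factorial_pos _)
  have hk : (0 : ℝ) < (k + 1).factorial := by positivity
  have hql : q ≤ s ^ l :=
    hq.trans (div_le_self (by positivity) (by exact_mod_cast Nat.factorial_pos (l + 1)))
  calc p * q * ((k + 1).descFactorial (l + 1) : ℝ)
      ≤ s ^ k / (k + 1).factorial * s ^ l * (k + 1).factorial := by gcongr
    _ = s ^ k * s ^ l := by field_simp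

/-- Bound for a single summand of the double sum, when `l ≤ k`. -/
theorem weighted_gammaTail_le {s c B E t R γ x p q : ℝ} {k l : ℕ} (hlk : l ≤ k) (hs : 0 ≤ s)
    (hc : 0 ≤ c) (hB : 1 ≤ B) (hsB : 9 * s * B ≤ 1) (hR : 1 ≤ R) (hRB : s * Real.exp c * R ≤ B)
    (ht : 0 ≤ t) (hE : E = Real.exp t) (hx : γ * x ≤ R * t) (hp0 : 0 ≤ p) (hq0 : 0 ≤ q)
    (hp : p ≤ s ^ k / (k + 1).factorial) (hq : q ≤ s ^ l / (l + 1).factorial) :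
    p * q * min 1 (((k + 1).descFactorial (l + 1) : ℝ) *
      gammaTail (l + 1) (γ * x - (l + 1 : ℝ) * c)) ≤
    Real.exp (c - γ * x) * if l = 0 then s ^ k else
      (s * Real.exp c) ^ k * (s * Real.exp c) ^ l + (1 / 3) ^ k * (1 / 3) ^ l * (E - 1) := by
  subst hE
  have hE1 : 0 ≤ Real.exp t - 1 := by linarith [Real.one_le_exp ht]
  have hM : 1 ≤ Real.exp c := Real.one_le_exp hc
  set y := γ * x - (l + 1 : ℝ) * c with hy
  have hT := gammaTail_nonneg (l + 1) y
  have hmain : p * q * min 1 (((k + 1).descFactorial (l + 1) : ℝ) * gammaTail (l + 1) y) ≤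
      s ^ k * s ^ l * gammaTail (l + 1) y := by
    calc _ ≤ p * q * (((k + 1).descFactorial (l + 1) : ℝ) * gammaTail (l + 1) y) := by
          gcongr
          exact min_le_right _ _
      _ = p * q * ((k + 1).descFactorial (l + 1) : ℝ) * gammaTail (l + 1) y := by ring
      _ ≤ _ := by
          exact mul_le_mul_of_nonneg_right (mul_descFactorial_le hs hq0 hp hq) hT
  refine hmain.trans ?_
  split_ifs with hl
  · subst hl
    have hyc : -y = c - γ * x := by rw [hy]; push_cast; ring
    have := gammaTail_one_le y
    rw [hyc] at this
    rw [pow_zero, mul_one, mul_comm]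
    gcongr
  · have hyc : Real.exp (-y) = Real.exp (c - γ * x) * Real.exp c ^ l := by
      rw [← Real.exp_nat_mul, ← Real.exp_add, hy]
      congr 1
      ring
    have hyR : y ≤ R * t := by
      have : 0 ≤ (l + 1 : ℝ) * c := by positivity
      linarith
    have hfirst : s ^ k * (s * Real.exp c) ^ l ≤ (s * Real.exp c) ^ k * (s * Real.exp c) ^ l := by
      gcongr
      exact le_mul_of_one_le_right hs hM
    have hsecond : s ^ k * (s * Real.exp c * R) ^ l ≤ (1 / 3) ^ k * (1 / 3) ^ l := by
      calc s ^ k * (s * Real.exp c * R) ^ l ≤ s ^ k * B ^ l := by gcongr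
        _ ≤ s ^ k * B ^ k := by gcongr
        _ = (s * B) ^ k := (mul_pow _ _ _).symm
        _ ≤ (1 / 9) ^ k := by gcongr; linarith
        _ = (1 / 3) ^ k * (1 / 3) ^ k := by rw [← mul_pow]; norm_num
        _ ≤ (1 / 3) ^ k * (1 / 3) ^ l := by
          gcongr ?_ * ?_
          exact pow_le_pow_of_le_one (by norm_num) (by norm_num) hlk
    calc s ^ k * s ^ l * gammaTail (l + 1) y
        ≤ s ^ k * s ^ l * (Real.exp (-y) * (1 + R ^ l * (Real.exp t - 1))) := by
          gcongr
          exact gammaTail_succ_le l hR ht hyR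
      _ = Real.exp (c - γ * x) * (s ^ k * (s * Real.exp c) ^ l +
            s ^ k * (s * Real.exp c * R) ^ l * (Real.exp t - 1)) := by
          rw [hyc]; simp only [mul_pow]; ring
      _ ≤ _ := by gcongr

/-- Bound for the double sum with an arbitrary weight `q` dominated by `s ^ (k - 1) / k!`. -/
theorem tsum_weighted_gammaTail_le {s c B t R γ x : ℝ} (q : ℕ → ℝ) (hs : 0 ≤ s)
    (hc : 0 ≤ c) (hB : 1 ≤ B) (hsB : 9 * s * B ≤ 1) (hsM : 4 * s * Real.exp c ^ 2 ≤ 1)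
    (hR : 1 ≤ R) (hRB : s * Real.exp c * R ≤ B)
    (hst : 8 * s ≤ t) (hx : γ * x ≤ R * t) (hq0 : ∀ k, 0 ≤ q (k + 1))
    (hq : ∀ k, q (k + 1) ≤ s ^ k / (k + 1).factorial) :
    (∑' k : ℕ, ∑' l : ℕ, q (k + 1) * q (l + 1) *
      min 1 ((Nat.descFactorial (max (k + 1) (l + 1)) (min (k + 1) (l + 1)) : ℝ) *
        gammaTail (min (k + 1) (l + 1)) (γ * x - (min (k + 1) (l + 1) : ℝ) * c))) ≤
    Real.exp (c - γ * x) * Real.exp t := by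
  have ht : 0 ≤ t := by linarith
  have hM : 1 ≤ Real.exp c := Real.one_le_exp hc
  set M := Real.exp c with hMdef
  set E := Real.exp t with hE
  set K := Real.exp (c - γ * x) with hK
  have hK0 : 0 < K := Real.exp_pos _
  have hEt : t + 1 ≤ E := Real.add_one_le_exp t
  have hs9 : s ≤ 1 / 9 := by nlinarith
  have hsM4 : s * M ≤ 1 / 4 := by nlinarith [mul_nonneg hs (by linarith : 0 ≤ M)]
  have hsM0 : 0 ≤ s * M := by positivity
  let d : ℕ → ℝ := fun k => if k = 0 then 1 else 0
  let g : ℝ → ℕ → ℝ := fun a k => if k = 0 then 0 else a ^ k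
  have hd : HasSum d 1 := hasSum_ite_eq 0 1
  have hg {a : ℝ} (h0 : 0 ≤ a) (h1 : a < 1) : HasSum (g a) (a / (1 - a)) :=
    hasSum_geometric_of_ne_zero h0 h1
  have hsum := tsum_tsum_le_sum_mul (Finset.univ : Finset (Fin 4))
    (f := fun k l => q (k + 1) * q (l + 1) *
      min 1 ((Nat.descFactorial (max (k + 1) (l + 1)) (min (k + 1) (l + 1)) : ℝ) *
        gammaTail (min (k + 1) (l + 1)) (γ * x - (min (k + 1) (l + 1) : ℝ) * c)))
    (u := ![fun k => K * s ^ k, fun k => K * d k, fun k => K * g (s * M) k,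
      fun k => K * (E - 1) * g (1 / 3) k])
    (v := ![d, g s, g (s * M), g (1 / 3)])
    (U := ![K * (1 - s)⁻¹, K * 1, K * (s * M / (1 - s * M)),
      K * (E - 1) * ((1 / 3) / (1 - 1 / 3))])
    (V := ![1, s / (1 - s), s * M / (1 - s * M), (1 / 3) / (1 - 1 / 3)])
    ?_ ?_ ?_ ?_
  · refine hsum.trans ?_
    simp only [Fin.sum_univ_four, Matrix.cons_val]
    have h1 : (1 - s)⁻¹ ≤ 1 + 9 / 8 * s := by
      rw [inv_le_iff_one_le_mul₀ (by linarith)]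
      nlinarith
    have h2 : s / (1 - s) ≤ 9 / 8 * s := by
      rw [div_le_iff₀ (by linarith)]
      nlinarith
    have h3 : s * M / (1 - s * M) ≤ 2 * (s * M) := by
      rw [div_le_iff₀ (by linarith)]
      nlinarith
    have h30 : 0 ≤ s * M / (1 - s * M) := div_nonneg hsM0 (by linarith)
    have h4 : s * M / (1 - s * M) * (s * M / (1 - s * M)) ≤ s := by
      calc _ ≤ 2 * (s * M) * (2 * (s * M)) := by gcongr
        _ = s * (4 * s * M ^ 2) := by ring
        _ ≤ s * 1 := by gcongr
        _ = s := mul_one s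
    have : (1 - s)⁻¹ + s / (1 - s) + s * M / (1 - s * M) * (s * M / (1 - s * M)) +
        (E - 1) * (1 / 4) ≤ E := by linarith
    have := mul_le_mul_of_nonneg_left this hK0.le
    convert this using 1
    ring
  · intro k l
    have h1 := hq0 k
    have h2 := hq0 l
    have h3 := gammaTail_nonneg (min (k + 1) (l + 1)) (γ * x - (min (k + 1) (l + 1) : ℝ) * c)
    positivity
  · have key (k l : ℕ) (hlk : l ≤ k) := weighted_gammaTail_le (E := E) hlk hs hc hB hsB hR hRB ht
      hE hx (hq0 k) (hq0 l) (hq k) (hq l)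
    intro k l
    simp only [Fin.sum_univ_four, Matrix.cons_val]
    rcases le_total l k with h | h
    · have hmax : max (k + 1) (l + 1) = k + 1 := by omega
      have hmin : min (k + 1) (l + 1) = l + 1 := by omega
      have hminR : min ((k : ℝ) + 1) ((l : ℝ) + 1) = l + 1 := by
        exact_mod_cast congrArg (Nat.cast : ℕ → ℝ) hmin
      rw [hmax, hmin, hminR]
      refine (key k l h).trans (le_of_eq ?_)
      rcases Nat.eq_zero_or_pos l with rfl | hl
      · simp [d, g, hK]
      · have hk : k ≠ 0 := by omega
        simp only [d, g, hl.ne', hk, if_false]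
        ring
    · have hmax : max (k + 1) (l + 1) = l + 1 := by omega
      have hmin : min (k + 1) (l + 1) = k + 1 := by omega
      have hminR : min ((k : ℝ) + 1) ((l : ℝ) + 1) = k + 1 := by
        exact_mod_cast congrArg (Nat.cast : ℕ → ℝ) hmin
      rw [hmax, hmin, hminR, mul_comm (q (k + 1))]
      refine (key l k h).trans (le_of_eq ?_)
      rcases Nat.eq_zero_or_pos k with rfl | hk
      · rcases Nat.eq_zero_or_pos l with rfl | hl
        · simp [d, g, hK]
        · simp [d, g, hl.ne', hK]
      · have hl : l ≠ 0 := by omega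
        simp only [d, g, hk.ne', hl, if_false]
        ring
  · have e0 := (hasSum_geometric_of_lt_one hs (by linarith)).mul_left K
    have e1 := hd.mul_left K
    have e2 := (hg hsM0 (by linarith)).mul_left K
    have e3 := (hg (a := 1 / 3) (by norm_num) (by norm_num)).mul_left (K * (E - 1))
    intro i _
    fin_cases i
    exacts [e0, e1, e2, e3]
  · have e1 := hg hs (by linarith)
    have e2 := hg hsM0 (by linarith)
    have e3 := hg (a := 1 / 3) (by norm_num) (by norm_num)
    intro i _
    fin_cases i
    exacts [hd, e1, e2, e3]

/-- **Lemma A.1** (key analytic estimate): given `κ, C > 0` and `r ∈ (0,1)`, there are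
`c > 0` and `ε₀ > 0` such that for all `ε ∈ (0,ε₀)`, with `γ = 1 + rε`,
`q_1 = 1 - ε + κε²` and `q_k = (Cε)^{k-1}/k!` for `k ≥ 2`, one has for all `x > c`:
`Σ_{k,ℓ ≥ 1} q_k q_ℓ min(1, (k∨ℓ)^{(k∧ℓ)} F(k∧ℓ, γx - (k∧ℓ)c)) ≤ e^{-(x-c)}`. -/
theorem key_q_control (κ C r : ℝ) (hκ : 0 < κ) (hC : 0 < C) (hr : r ∈ Set.Ioo (0 : ℝ) 1) :
    ∃ c : ℝ, 0 < c ∧ ∃ ε₀ : ℝ, 0 < ε₀ ∧ ∀ ε : ℝ, ε ∈ Set.Ioo 0 ε₀ →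
      ∀ x : ℝ, c < x →
        (∑' k : ℕ, ∑' l : ℕ,
          (fun j : ℕ => if j = 1 then 1 - ε + κ * ε ^ 2
            else (C * ε) ^ (j - 1) / (Nat.factorial j)) (k + 1) *
          (fun j : ℕ => if j = 1 then 1 - ε + κ * ε ^ 2
            else (C * ε) ^ (j - 1) / (Nat.factorial j)) (l + 1) *
          min 1 ((Nat.descFactorial (max (k + 1) (l + 1)) (min (k + 1) (l + 1)) : ℝ) *
            gammaTail (min (k + 1) (l + 1))
              ((1 + r * ε) * x - (min (k + 1) (l + 1) : ℝ) * c))) ≤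
        Real.exp (-(x - c)) := by
  obtain ⟨hr0, hr1⟩ := hr
  set c := 8 * C / r with hc
  have hc0 : 0 < c := by positivity
  set M := Real.exp c with hM
  have hM0 : 0 < M := Real.exp_pos c
  set B := 1 + 2 * C * M / r with hB
  have hB1 : 1 ≤ B := by
    have : 0 ≤ 2 * C * M / r := by positivity
    linarith
  have hB0 : 0 < B := by linarith
  set D := 1 + κ + 9 * C * B + 4 * C * M ^ 2 with hD
  have hD0 : 0 < D := by positivity
  refine ⟨c, hc0, 1 / D, by positivity, fun ε hε x hx => ?_⟩
  obtain ⟨hε0, hεD⟩ := hε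
  rw [lt_div_iff₀ hD0] at hεD
  have hε1 : 0 < ε * κ := by positivity
  have hε2 : 0 < ε * (9 * C * B) := by positivity
  have hε3 : 0 < ε * (4 * C * M ^ 2) := by positivity
  have hsplit : ε * D = ε + ε * κ + ε * (9 * C * B) + ε * (4 * C * M ^ 2) := by rw [hD]; ring
  have hx0 : 0 < x := hc0.trans hx
  have hrε : r * ε ≤ 1 := by nlinarith
  have hrε0 : 0 < r * ε := by positivity
  have hst : 8 * (C * ε) ≤ r * ε * x := by
    calc 8 * (C * ε) = r * ε * c := by rw [hc]; field_simp
      _ ≤ r * ε * x := by gcongr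
  refine (tsum_weighted_gammaTail_le (s := C * ε) (c := c) (B := B) (t := r * ε * x)
    (R := 2 / (r * ε)) (γ := 1 + r * ε) (x := x)
    (fun j : ℕ => if j = 1 then 1 - ε + κ * ε ^ 2 else (C * ε) ^ (j - 1) / (Nat.factorial j))
    (by positivity) hc0.le hB1 (by linarith) (by linarith) ?_ ?_ hst ?_ ?_ ?_).trans ?_
  · rw [le_div_iff₀ hrε0]
    linarith
  · calc C * ε * M * (2 / (r * ε)) = 2 * C * M / r := by field_simp
      _ ≤ B := by linarith
  · have : 2 / (r * ε) * (r * ε * x) = 2 * x := by field_simp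
    rw [this]
    gcongr
    linarith
  · rintro (_ | k)
    · simp only [zero_add, if_true]
      have : 0 ≤ κ * ε ^ 2 := by positivity
      linarith
    · simp only [Nat.add_eq_right, Nat.add_eq_zero_iff, one_ne_zero, and_false, if_false]
      positivity
  · rintro (_ | k)
    · simp only [zero_add, if_true, pow_zero, Nat.factorial_one, Nat.cast_one, div_one]
      nlinarith
    · simp
  · rw [← Real.exp_add]
    exact Real.exp_le_exp.mpr (by linarith)

end Paper
end

section
/- Let T and T' be finite rooted trees and let d ≥ 1. Then the matching weight satisfies the recursion W_d(T,T') = max over maximal injective partial mappings m from the set of children of the root of T to the set of children of the root of T' of Σ_{(k,w) ∈ m} W_{d-1}(T^{(k)}, T'^{(w)}), where T^{(k)} denotes the subtree of T rooted at the child k (and the maximum is 0 when either root has no children); here a maximal injective partial mapping is an injective map defined on a subset of the children of root(T) into the children of root(T') that is not the restriction of another injective partial map with strictly larger domain. Moreover W_0(T,T') = 1. -/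
open MeasureTheory ProbabilityTheory Real Filter Set
open scoped Classical

namespace Paper

/-- Ulam–Harris vertex space. -/
abbrev UH := List ℕ

/-- A rooted tree: prefix-closed set of Ulam–Harris vertices containing the root `[]`. -/
def IsTree (T : Set UH) : Prop := [] ∈ T ∧ ∀ (v : UH) (i : ℕ), v ++ [i] ∈ T → v ∈ T

/-- Injective root- and parent-preserving embedding of the Ulam–Harris tree `t` into an
abstract rooted structure with root `root` and child relation `child`. -/
def IsEmbRel {α : Type*} (t : Set UH) (root : α) (child : α → α → Prop) (f : UH → α) : Prop :=
  f [] = root ∧ (∀ (v : UH) (i : ℕ), v ++ [i] ∈ t → child (f v) (f (v ++ [i]))) ∧ Set.InjOn f t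

/-- `t` is a finite rooted tree all of whose leaves are at depth exactly `d`. -/
def IsAd (d : ℕ) (t : Set UH) : Prop :=
  IsTree t ∧ t.Finite ∧ ∀ v ∈ t, (∀ i : ℕ, v ++ [i] ∉ t) → v.length = d

/-- Matching weight at depth `d` between two abstract rooted structures: the largest number
of depth-`d` leaves of a tree of `A_d` embeddable in both. -/
noncomputable def matchWRel {α β : Type*} (d : ℕ) (ra : α) (ca : α → α → Prop)
    (rb : β) (cb : β → β → Prop) : ℕ :=
  sSup {w : ℕ | ∃ t : Set UH, IsAd d t ∧ (∃ f, IsEmbRel t ra ca f) ∧ (∃ g, IsEmbRel t rb cb g) ∧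
    w = {v ∈ t | v.length = d}.ncard}

/-- Child relation of an Ulam–Harris tree. -/
def uhChild (T : Set UH) (v w : UH) : Prop := v ∈ T ∧ w ∈ T ∧ ∃ i : ℕ, w = v ++ [i]

/-- Matching weight at depth `d` between two Ulam–Harris rooted trees. -/
noncomputable def matchW (d : ℕ) (T T' : Set UH) : ℕ :=
  matchWRel d ([] : UH) (uhChild T) ([] : UH) (uhChild T')

/-- The subtree of `T` rooted at the child `i` of the root. -/
def subtreeAt (T : Set UH) (i : ℕ) : Set UH := {v | i :: v ∈ T}

/-- `m` is a maximal injective partial mapping (matching) from `Cl` to `Cr`: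
it is a partial injective map, and it is not the restriction of another injective partial
map with strictly larger domain. -/
def IsMaxMatching (Cl Cr : Set ℕ) (m : Set (ℕ × ℕ)) : Prop :=
  (∀ p ∈ m, p.1 ∈ Cl ∧ p.2 ∈ Cr) ∧
  (∀ p ∈ m, ∀ q ∈ m, (p.1 = q.1 ↔ p.2 = q.2)) ∧
  ¬ ∃ i ∈ Cl, ∃ j ∈ Cr, (∀ p ∈ m, p.1 ≠ i) ∧ (∀ p ∈ m, p.2 ≠ j)

lemma finsum_mem_one_eq_ncard {α : Type*} {s : Set α} (hs : s.Finite) :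
    ∑ᶠ _a ∈ s, (1 : ℕ) = s.ncard := by
  rw [finsum_mem_eq_finite_toFinset_sum _ hs, Set.ncard_eq_toFinset_card s hs,
    Finset.card_eq_sum_ones]

lemma finsum_mem_le_finsum_mem_of_subset {α : Type*} {s t : Set α} {f g : α → ℕ}
    (ht : t.Finite) (hst : s ⊆ t) (hfg : ∀ a ∈ s, f a ≤ g a) :
    ∑ᶠ a ∈ s, f a ≤ ∑ᶠ a ∈ t, g a := by
  have hs := ht.subset hst
  rw [finsum_mem_eq_finite_toFinset_sum _ hs, finsum_mem_eq_finite_toFinset_sum _ ht]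
  calc ∑ a ∈ hs.toFinset, f a ≤ ∑ a ∈ hs.toFinset, g a :=
        Finset.sum_le_sum fun a ha => hfg a (by simpa using ha)
    _ ≤ ∑ a ∈ ht.toFinset, g a :=
        Finset.sum_le_sum_of_subset (by simpa using hst)

/-- The vertices of `t` at depth `d`. -/
def level (d : ℕ) (t : Set UH) : Set UH := {v ∈ t | v.length = d}

lemma finite_level (d : ℕ) {t : Set UH} (ht : t.Finite) : (level d t).Finite :=
  ht.subset (Set.sep_subset _ _)

lemma IsTree.singleton_mem {t : Set UH} (ht : IsTree t) {i : ℕ} {v : UH} (h : i :: v ∈ t) :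
    [i] ∈ t := by
  induction v using List.reverseRecOn with
  | nil => exact h
  | append_singleton u j ih => exact ih (ht.2 (i :: u) j (by simpa using h))

lemma IsTree.subtreeAt {t : Set UH} (ht : IsTree t) {i : ℕ} (hi : [i] ∈ t) :
    IsTree (subtreeAt t i) :=
  ⟨hi, fun v j h => ht.2 (i :: v) j (by simpa [Paper.subtreeAt] using h)⟩

lemma finite_subtreeAt {t : Set UH} (ht : t.Finite) (i : ℕ) : (subtreeAt t i).Finite :=
  ht.preimage (List.cons_injective.injOn)

lemma finite_children {t : Set UH} (ht : t.Finite) : {i : ℕ | [i] ∈ t}.Finite :=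
  ht.preimage (fun _ _ _ _ h => by simpa using h)

lemma IsAd.subtreeAt {d : ℕ} {t : Set UH} (ht : IsAd (d + 1) t) {i : ℕ} (hi : [i] ∈ t) :
    IsAd d (subtreeAt t i) := by
  refine ⟨ht.1.subtreeAt hi, finite_subtreeAt ht.2.1 i, fun v hv hleaf => ?_⟩
  have := ht.2.2 (i :: v) hv fun j => hleaf j
  simpa using this

/-- The depth-`d + 1` vertices of a tree are partitioned by the children of the root. -/
lemma ncard_level_succ (d : ℕ) {t : Set UH} (ht : IsTree t) (hfin : t.Finite) :
    (level (d + 1) t).ncard = ∑ᶠ i ∈ {i : ℕ | [i] ∈ t}, (level d (subtreeAt t i)).ncard := by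
  have hlev : ∀ i, (level d (subtreeAt t i)).Finite := fun i =>
    finite_level d (finite_subtreeAt hfin i)
  have hunion : level (d + 1) t =
      ⋃ i ∈ {i : ℕ | [i] ∈ t}, List.cons i '' level d (subtreeAt t i) := by
    ext v
    simp only [level, subtreeAt, Set.mem_iUnion, Set.mem_image, Set.mem_ofPred_eq, exists_prop]
    constructor
    · rintro ⟨hv, hl⟩
      obtain ⟨i, u, rfl⟩ := List.exists_cons_of_length_eq_add_one hl
      exact ⟨i, ht.singleton_mem hv, u, ⟨hv, by simpa using hl⟩, rfl⟩
    · rintro ⟨i, -, u, ⟨hu, hl⟩, rfl⟩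
      exact ⟨hu, by simp [hl]⟩
  rw [← finsum_mem_one_eq_ncard (finite_level _ hfin), hunion,
    finsum_mem_biUnion _ (finite_children hfin) fun i _ => (hlev i).image _]
  · refine finsum_mem_congr rfl fun i _ => ?_
    rw [finsum_mem_one_eq_ncard ((hlev i).image _),
      Set.ncard_image_of_injective _ List.cons_injective]
  · intro i _ j _ hij
    refine Set.disjoint_left.2 ?_
    rintro _ ⟨u, -, rfl⟩ ⟨v, -, h⟩
    exact hij (List.cons.inj h).1.symm

lemma IsEmbRel.mem {t T : Set UH} {f : UH → UH} (hT : [] ∈ T) (hf : IsEmbRel t [] (uhChild T) f)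
    {v : UH} (hv : v ∈ t) : f v ∈ T := by
  induction v using List.reverseRecOn with
  | nil => rw [hf.1]; exact hT
  | append_singleton u j _ => exact (hf.2.1 u j hv).2.1

lemma IsEmbRel.exists_map_singleton {t T : Set UH} {f : UH → UH}
    (hf : IsEmbRel t [] (uhChild T) f) {i : ℕ} (hi : [i] ∈ t) : ∃ a, f [i] = [a] := by
  obtain ⟨-, -, a, ha⟩ := hf.2.1 [] i hi
  exact ⟨a, by simpa [hf.1] using ha⟩

lemma IsEmbRel.map_cons {t T : Set UH} {f : UH → UH} (ht : IsTree t)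
    (hf : IsEmbRel t [] (uhChild T) f) {i a : ℕ} (ha : f [i] = [a]) {v : UH} (hv : i :: v ∈ t) :
    f (i :: v) = a :: (f (i :: v)).tail := by
  induction v using List.reverseRecOn with
  | nil => simp [ha]
  | append_singleton u j ih =>
    have hv' : (i :: u) ++ [j] ∈ t := hv
    obtain ⟨-, -, k, hk⟩ := hf.2.1 _ j hv'
    have hk' : f (i :: (u ++ [j])) = f (i :: u) ++ [k] := hk
    rw [hk', ih (ht.2 _ _ hv')]
    simp

lemma IsEmbRel.subtreeAt {t T : Set UH} {f : UH → UH} (ht : IsTree t)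
    (hf : IsEmbRel t [] (uhChild T) f) {i a : ℕ} (ha : f [i] = [a]) :
    IsEmbRel (subtreeAt t i) [] (uhChild (subtreeAt T a)) fun v => (f (i :: v)).tail := by
  refine ⟨by simp [ha], fun v j hv => ?_, fun u hu v hv huv => ?_⟩
  · have hv' : (i :: v) ++ [j] ∈ t := hv
    obtain ⟨h1, h2, k, hk⟩ := hf.2.1 _ j hv'
    have e := hf.map_cons ht ha (ht.2 _ _ hv')
    have e' := hf.map_cons ht ha (v := v ++ [j]) hv'
    refine ⟨?_, ?_, k, ?_⟩
    · change a :: _ ∈ T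
      rwa [← e]
    · change a :: _ ∈ T
      rwa [← e']
    · change (f ((i :: v) ++ [j])).tail = _
      rw [hk, e]
      simp
  · have : f (i :: u) = f (i :: v) := by
      rw [hf.map_cons ht ha hu, hf.map_cons ht ha hv]
      exact congrArg (List.cons a) huv
    exact (List.cons.inj (hf.2.2 hu hv this)).2

/-- `t` is a tree of `A_d` which embeds in both `T` and `T'`. -/
def IsCommonAd (d : ℕ) (T T' t : Set UH) : Prop :=
  IsAd d t ∧ (∃ f, IsEmbRel t [] (uhChild T) f) ∧ ∃ g, IsEmbRel t [] (uhChild T') g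

lemma matchW_eq_sSup (d : ℕ) (T T' : Set UH) :
    matchW d T T' = sSup {w | ∃ t, IsCommonAd d T T' t ∧ w = (level d t).ncard} := by
  simp only [matchW, matchWRel, IsCommonAd, level, and_assoc]

lemma bddAbove_ncard_level (d : ℕ) {T : Set UH} (T' : Set UH) (hT : [] ∈ T) (hfin : T.Finite) :
    BddAbove {w | ∃ t, IsCommonAd d T T' t ∧ w = (level d t).ncard} := by
  refine ⟨T.ncard, ?_⟩
  rintro _ ⟨t, ⟨-, ⟨f, hf⟩, -⟩, rfl⟩
  exact Set.ncard_le_ncard_of_injOn f (fun v hv => hf.mem hT hv.1)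
    (hf.2.2.mono (Set.sep_subset _ _)) hfin

lemma IsCommonAd.ncard_level_le {d : ℕ} {T T' t : Set UH} (hT : [] ∈ T) (hfin : T.Finite)
    (ht : IsCommonAd d T T' t) : (level d t).ncard ≤ matchW d T T' := by
  rw [matchW_eq_sSup]
  exact le_csSup (bddAbove_ncard_level d T' hT hfin) ⟨t, ht, rfl⟩

lemma exists_ncard_level_eq_matchW {d : ℕ} {T T' : Set UH} (hT : [] ∈ T) (hfin : T.Finite)
    (h : matchW d T T' ≠ 0) :
    ∃ t, IsCommonAd d T T' t ∧ matchW d T T' = (level d t).ncard := by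
  rw [matchW_eq_sSup] at h ⊢
  refine Nat.sSup_mem (Set.nonempty_iff_ne_empty.2 fun he => h ?_)
    (bddAbove_ncard_level d T' hT hfin)
  rw [he, csSup_empty, bot_eq_zero]

/-- The tree whose root has child set `S` with the tree `τ k` attached at each `k ∈ S`. -/
def graft (S : Set ℕ) (τ : ℕ → Set UH) : Set UH :=
  {v | v = [] ∨ ∃ k ∈ S, ∃ u ∈ τ k, v = k :: u}

lemma nil_mem_graft (S : Set ℕ) (τ : ℕ → Set UH) : [] ∈ graft S τ := Or.inl rfl

@[simp]
lemma cons_mem_graft {S : Set ℕ} {τ : ℕ → Set UH} {k : ℕ} {u : UH} :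
    k :: u ∈ graft S τ ↔ k ∈ S ∧ u ∈ τ k := by
  simp [graft]

lemma isTree_graft {S : Set ℕ} {τ : ℕ → Set UH} (h : ∀ k ∈ S, IsTree (τ k)) :
    IsTree (graft S τ) := by
  refine ⟨nil_mem_graft S τ, fun v i hv => ?_⟩
  cases v with
  | nil => exact nil_mem_graft S τ
  | cons k u =>
    rw [List.cons_append, cons_mem_graft] at hv
    exact cons_mem_graft.2 ⟨hv.1, (h k hv.1).2 u i hv.2⟩

lemma finite_graft {S : Set ℕ} {τ : ℕ → Set UH} (hS : S.Finite) (h : ∀ k ∈ S, (τ k).Finite) :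
    (graft S τ).Finite := by
  refine ((Set.finite_singleton []).union
    (hS.biUnion fun k hk => (h k hk).image (List.cons k))).subset ?_
  rintro v (rfl | ⟨k, hk, u, hu, rfl⟩)
  · exact Or.inl rfl
  · exact Or.inr (Set.mem_biUnion hk ⟨u, hu, rfl⟩)

lemma isAd_graft {d : ℕ} {S : Set ℕ} {τ : ℕ → Set UH} (hS : S.Finite) (hne : S.Nonempty)
    (h : ∀ k ∈ S, IsAd d (τ k)) : IsAd (d + 1) (graft S τ) := by
  refine ⟨isTree_graft fun k hk => (h k hk).1, finite_graft hS fun k hk => (h k hk).2.1,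
    fun v hv hleaf => ?_⟩
  cases v with
  | nil =>
    obtain ⟨k, hk⟩ := hne
    exact absurd (cons_mem_graft.2 ⟨hk, (h k hk).1.1⟩) (hleaf k)
  | cons k u =>
    rw [cons_mem_graft] at hv
    rw [List.length_cons, (h k hv.1).2.2 u hv.2 fun i hi =>
      hleaf i (by rw [List.cons_append]; exact cons_mem_graft.2 ⟨hv.1, hi⟩)]

lemma ncard_level_graft {d : ℕ} {S : Set ℕ} {τ : ℕ → Set UH} (hS : S.Finite)
    (h : ∀ k ∈ S, IsAd d (τ k)) :
    (level (d + 1) (graft S τ)).ncard = ∑ᶠ k ∈ S, (level d (τ k)).ncard := by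
  rw [ncard_level_succ d (isTree_graft fun k hk => (h k hk).1)
    (finite_graft hS fun k hk => (h k hk).2.1)]
  refine finsum_mem_congr ?_ fun k hk => ?_
  · ext k
    simpa using fun hk => (h k hk).1.1
  · congr 2
    ext u
    simp [subtreeAt, hk]

lemma exists_isEmbRel_graft {S : Set ℕ} {τ : ℕ → Set UH} {T : Set UH} {σ : ℕ → ℕ}
    {f : ℕ → UH → UH} (hT : [] ∈ T) (hσ : Set.InjOn σ S) (hσT : ∀ k ∈ S, [σ k] ∈ T)
    (hf : ∀ k ∈ S, IsEmbRel (τ k) [] (uhChild (subtreeAt T (σ k))) (f k)) :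
    ∃ F, IsEmbRel (graft S τ) [] (uhChild T) F := by
  let F : UH → UH
    | [] => []
    | k :: u => σ k :: f k u
  refine ⟨F, rfl, fun v i hv => ?_, fun u hu v hv huv => ?_⟩
  · cases v with
    | nil =>
      have hk : i ∈ S := (cons_mem_graft.1 hv).1
      have e : F ([] ++ [i]) = [σ i] := by simp [F, (hf i hk).1]
      rw [e]
      exact ⟨hT, hσT i hk, σ i, rfl⟩
    | cons k u =>
      rw [List.cons_append, cons_mem_graft] at hv
      obtain ⟨h1, h2, j, hj⟩ := (hf k hv.1).2.1 u i hv.2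
      exact ⟨h1, h2, j, congrArg (List.cons (σ k)) hj⟩
  · match u, v with
    | [], [] => rfl
    | [], k :: v => simp [F] at huv
    | k :: u, [] => simp [F] at huv
    | k :: u, l :: v =>
      rw [cons_mem_graft] at hu hv
      obtain ⟨h1, h2⟩ := List.cons.inj (show σ k :: f k u = σ l :: f l v from huv)
      obtain rfl := hσ hu.1 hv.1 h1
      rw [(hf k hu.1).2.2 hu.2 hv.2 h2]

lemma exists_isMaxMatching_superset {Cl Cr : Set ℕ} (hl : Cl.Finite) (hr : Cr.Finite)
    {m₀ : Set (ℕ × ℕ)} (hm₀ : m₀ ⊆ Cl ×ˢ Cr)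
    (hinj : ∀ p ∈ m₀, ∀ q ∈ m₀, (p.1 = q.1 ↔ p.2 = q.2)) :
    ∃ m, m₀ ⊆ m ∧ IsMaxMatching Cl Cr m := by
  have hfin : {m : Set (ℕ × ℕ) | m ⊆ Cl ×ˢ Cr ∧
      ∀ p ∈ m, ∀ q ∈ m, (p.1 = q.1 ↔ p.2 = q.2)}.Finite :=
    (hl.prod hr).finite_subsets.subset fun m hm => hm.1
  obtain ⟨m, hle, ⟨hm, hmi⟩, hmax⟩ := hfin.exists_le_maximal ⟨hm₀, hinj⟩
  refine ⟨m, hle, fun p hp => hm hp, hmi, ?_⟩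
  rintro ⟨i, hi, j, hj, h1, h2⟩
  have hins : insert (i, j) m ⊆ m := by
    refine hmax ⟨Set.insert_subset ⟨hi, hj⟩ hm, ?_⟩ (Set.subset_insert _ _)
    rintro p (rfl | hp) q (rfl | hq)
    · simp
    · exact iff_of_false (h1 q hq).symm (h2 q hq).symm
    · exact iff_of_false (h1 p hp) (h2 p hp)
    · exact hmi p hp q hq
  exact h1 _ (hins (Set.mem_insert _ _)) rfl

lemma IsMaxMatching.subset_prod {Cl Cr : Set ℕ} {m : Set (ℕ × ℕ)} (hm : IsMaxMatching Cl Cr m) :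
    m ⊆ Cl ×ˢ Cr :=
  fun p hp => hm.1 p hp

/-- A common tree at depth `d + 1` induces a maximal matching of the children of the two roots
whose total weight is at least its number of leaves. -/
lemma IsCommonAd.exists_isMaxMatching {d : ℕ} {T T' t : Set UH}
    (hT : [] ∈ T) (hT' : [] ∈ T') (hfin : T.Finite) (hfin' : T'.Finite)
    (ht : IsCommonAd (d + 1) T T' t) :
    ∃ m, IsMaxMatching {i | [i] ∈ T} {j | [j] ∈ T'} m ∧
      (level (d + 1) t).ncard ≤
        ∑ᶠ p ∈ m, matchW d (subtreeAt T p.1) (subtreeAt T' p.2) := by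
  obtain ⟨had, ⟨f, hf⟩, g, hg⟩ := ht
  choose! a ha using fun (i : ℕ) (hi : i ∈ {i : ℕ | [i] ∈ t}) => hf.exists_map_singleton hi
  choose! b hb using fun (i : ℕ) (hi : i ∈ {i : ℕ | [i] ∈ t}) => hg.exists_map_singleton hi
  have haT : ∀ i ∈ {i : ℕ | [i] ∈ t}, [a i] ∈ T := fun i hi => ha i hi ▸ hf.mem hT hi
  have hbT : ∀ i ∈ {i : ℕ | [i] ∈ t}, [b i] ∈ T' := fun i hi => hb i hi ▸ hg.mem hT' hi
  have hai : Set.InjOn a {i : ℕ | [i] ∈ t} := fun i hi j hj h => by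
    simpa using hf.2.2 hi hj (by rw [ha i hi, ha j hj, h])
  have hbi : Set.InjOn b {i : ℕ | [i] ∈ t} := fun i hi j hj h => by
    simpa using hg.2.2 hi hj (by rw [hb i hi, hb j hj, h])
  have hsub : (fun i => (a i, b i)) '' {i : ℕ | [i] ∈ t} ⊆ {i | [i] ∈ T} ×ˢ {j | [j] ∈ T'} := by
    rintro _ ⟨i, hi, rfl⟩
    exact ⟨haT i hi, hbT i hi⟩
  obtain ⟨m, hle, hm⟩ := exists_isMaxMatching_superset (finite_children hfin)
    (finite_children hfin') hsub (by
      rintro _ ⟨i, hi, rfl⟩ _ ⟨j, hj, rfl⟩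
      exact (hai.eq_iff hi hj).trans (hbi.eq_iff hi hj).symm)
  refine ⟨m, hm, ?_⟩
  rw [ncard_level_succ d had.1 had.2.1]
  calc ∑ᶠ i ∈ {i : ℕ | [i] ∈ t}, (level d (subtreeAt t i)).ncard
      ≤ ∑ᶠ i ∈ {i : ℕ | [i] ∈ t}, matchW d (subtreeAt T (a i)) (subtreeAt T' (b i)) :=
        finsum_mem_le_finsum_mem_of_subset (finite_children had.2.1) subset_rfl fun i hi =>
          IsCommonAd.ncard_level_le (haT i hi) (finite_subtreeAt hfin _)
            ⟨had.subtreeAt hi, ⟨_, hf.subtreeAt had.1 (ha i hi)⟩,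
              ⟨_, hg.subtreeAt had.1 (hb i hi)⟩⟩
    _ = ∑ᶠ p ∈ (fun i => (a i, b i)) '' {i : ℕ | [i] ∈ t},
          matchW d (subtreeAt T p.1) (subtreeAt T' p.2) := by
        rw [finsum_mem_image]
        exact fun i hi j hj h => hai hi hj (Prod.mk.inj h).1
    _ ≤ _ := finsum_mem_le_finsum_mem_of_subset
        (((finite_children hfin).prod (finite_children hfin')).subset hm.subset_prod) hle
        fun _ _ => le_rfl

/-- The total weight of a matching of the children of the two roots is bounded by the matching
weight of the two trees. -/
lemma finsum_mem_matchW_le {d : ℕ} {T T' : Set UH} (hT : [] ∈ T) (hT' : [] ∈ T')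
    (hfin : T.Finite) {m : Set (ℕ × ℕ)}
    (hm : ∀ p ∈ m, [p.1] ∈ T ∧ [p.2] ∈ T') (hinj : ∀ p ∈ m, ∀ q ∈ m, (p.1 = q.1 ↔ p.2 = q.2)) :
    ∑ᶠ p ∈ m, matchW d (subtreeAt T p.1) (subtreeAt T' p.2) ≤ matchW (d + 1) T T' := by
  let S : Set ℕ :=
    {k | ∃ w, (k, w) ∈ m ∧ matchW d (subtreeAt T k) (subtreeAt T' w) ≠ 0}
  have hSdef : ∀ k ∈ S, ∃ w, (k, w) ∈ m ∧ matchW d (subtreeAt T k) (subtreeAt T' w) ≠ 0 :=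
    fun k hk => hk
  choose! σ hσm hσ using hSdef
  choose! τ hτ hτw using fun k hk => exists_ncard_level_eq_matchW
    (show [] ∈ subtreeAt T k from (hm _ (hσm k hk)).1) (finite_subtreeAt hfin k) (hσ k hk)
  have hSfin : S.Finite := (finite_children hfin).subset fun k hk => (hm _ (hσm k hk)).1
  have hsum : ∑ᶠ p ∈ m, matchW d (subtreeAt T p.1) (subtreeAt T' p.2) =
      ∑ᶠ k ∈ S, (level d (τ k)).ncard := by
    rw [← finsum_mem_inter_support]
    symm
    refine finsum_mem_eq_of_bijOn (fun k => (k, σ k)) ⟨fun k hk => ⟨hσm k hk, hσ k hk⟩,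
      fun k _ l _ h => (Prod.mk.inj h).1, ?_⟩ fun k hk => (hτw k hk).symm
    rintro ⟨k, w⟩ ⟨hkw, hne⟩
    have hk : k ∈ S := ⟨w, hkw, hne⟩
    exact ⟨k, hk, Prod.ext rfl ((hinj _ (hσm k hk) _ hkw).1 rfl)⟩
  rw [hsum]
  rcases S.eq_empty_or_nonempty with hS | hS
  · simp [hS]
  · rw [← ncard_level_graft hSfin fun k hk => (hτ k hk).1]
    choose! f hf using fun k hk => (hτ k hk).2.1
    choose! g hg using fun k hk => (hτ k hk).2.2
    exact IsCommonAd.ncard_level_le hT hfin ⟨isAd_graft hSfin hS fun k hk => (hτ k hk).1,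
      exists_isEmbRel_graft (σ := id) hT (Set.injOn_id _) (fun k hk => (hm _ (hσm k hk)).1) hf,
      exists_isEmbRel_graft hT' (fun k hk l hl h => (hinj _ (hσm k hk) _ (hσm l hl)).2 h)
        (fun k hk => (hm _ (hσm k hk)).2) hg⟩

lemma IsAd.eq_singleton_nil {t : Set UH} (ht : IsAd 0 t) : t = {[]} := by
  refine Set.Subset.antisymm (fun v hv => ?_) (Set.singleton_subset_iff.2 ht.1.1)
  obtain ⟨u, hu, hmax⟩ := Set.exists_max_image t List.length ht.2.1 ⟨v, hv⟩
  have hu0 : u.length = 0 := ht.2.2 u hu fun i hi => by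
    simpa using hmax _ hi
  exact List.length_eq_zero_iff.1 (Nat.le_zero.1 (hu0 ▸ hmax v hv))

lemma isAd_singleton_nil : IsAd 0 {[]} := by
  refine ⟨⟨rfl, fun v i h => ?_⟩, Set.finite_singleton _, fun v hv _ => ?_⟩
  · simp at h
  · simpa using hv

lemma matchW_zero (T T' : Set UH) : matchW 0 T T' = 1 := by
  have hlev : (level 0 {[]}).ncard = 1 := by
    rw [show level 0 {[]} = {[]} by ext v; simp [level], Set.ncard_singleton]
  have hemb (T : Set UH) : IsEmbRel {[]} [] (uhChild T) id :=
    ⟨rfl, fun v i h => by simp at h, Set.injOn_id _⟩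
  rw [matchW_eq_sSup, show {w | ∃ t, IsCommonAd 0 T T' t ∧ w = (level 0 t).ncard} = {1} from ?_,
    csSup_singleton]
  ext w
  constructor
  · rintro ⟨t, ht, rfl⟩
    rw [ht.1.eq_singleton_nil, hlev]
    rfl
  · rintro rfl
    exact ⟨{[]}, ⟨isAd_singleton_nil, ⟨id, hemb T⟩, ⟨id, hemb T'⟩⟩, hlev.symm⟩

/-- **Recursion for matching weights** (formulas (3) and (4)): `W_0(T,T') = 1` and, for
`d ≥ 1`, `W_d(T,T')` is the maximum over maximal injective partial matchings `m` between
the children of the two roots of `Σ_{(k,w) ∈ m} W_{d-1}(T^{(k)}, T'^{(w)})`. -/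
theorem matchW_recursion (T T' : Set UH) (hT : IsTree T) (hT' : IsTree T')
    (hTfin : T.Finite) (hT'fin : T'.Finite) :
    matchW 0 T T' = 1 ∧
    ∀ d : ℕ, 1 ≤ d →
      matchW d T T' =
        sSup {w : ℕ | ∃ m : Set (ℕ × ℕ),
          IsMaxMatching {i : ℕ | [i] ∈ T} {j : ℕ | [j] ∈ T'} m ∧
          w = ∑ᶠ p ∈ m, matchW (d - 1) (subtreeAt T p.1) (subtreeAt T' p.2)} := by
  refine ⟨matchW_zero T T', fun d hd => ?_⟩
  obtain ⟨d, rfl⟩ := Nat.exists_eq_add_of_le' hd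
  rw [Nat.add_sub_cancel]
  have hle : ∀ m, IsMaxMatching {i : ℕ | [i] ∈ T} {j : ℕ | [j] ∈ T'} m →
      ∑ᶠ p ∈ m, matchW d (subtreeAt T p.1) (subtreeAt T' p.2) ≤ matchW (d + 1) T T' :=
    fun m hm => finsum_mem_matchW_le hT.1 hT'.1 hTfin hm.1 hm.2.1
  apply le_antisymm
  · rw [matchW_eq_sSup]
    refine csSup_le' ?_
    rintro _ ⟨t, ht, rfl⟩
    obtain ⟨m, hm, hw⟩ := ht.exists_isMaxMatching hT.1 hT'.1 hTfin hT'fin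
    refine hw.trans (le_csSup ⟨matchW (d + 1) T T', ?_⟩ ⟨m, hm, rfl⟩)
    rintro _ ⟨m, hm, rfl⟩
    exact hle m hm
  · refine csSup_le' ?_
    rintro _ ⟨m, hm, rfl⟩
    exact hle m hm

end Paper
end

section
/- There exist ε₀ > 0 and M > 0 such that for every ε ∈ (0, ε₀], letting λ = 1 + ε and letting p_e(λ) be the smallest root in [0,1] of the equation x = exp(-λ(1-x)), one has |p_e(λ) - (1 - 2ε)| ≤ M ε². -/
open Real

namespace Paper

/-- For small `ε > 0` the extinction equation has a root strictly below `1`. -/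
lemma exists_root_lt_one {ε : ℝ} (h0 : 0 < ε) (h1 : ε ≤ 1 / 4) :
    ∃ q ∈ Set.Icc (0 : ℝ) 1, q < 1 ∧ q = Real.exp (-(1 + ε) * (1 - q)) := by
  have hexp := Real.abs_exp_sub_one_sub_id_le (x := -(1 + ε) * (ε / 2))
    (by rw [abs_le]; constructor <;> nlinarith)
  have hneg : Real.exp (-(1 + ε) * (1 - (1 - ε / 2))) - (1 - ε / 2) ≤ 0 := by
    have h := (abs_le.mp hexp).2
    rw [sub_sub_cancel]
    have hsq : (1 + ε) ^ 2 ≤ 2 := by nlinarith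
    nlinarith [mul_le_mul_of_nonneg_right hsq (sq_nonneg ε)]
  have hcont : ContinuousOn (fun x : ℝ => Real.exp (-(1 + ε) * (1 - x)) - x)
      (Set.Icc 0 (1 - ε / 2)) := by fun_prop
  obtain ⟨q, hq, hroot⟩ := intermediate_value_Icc' (by linarith : (0 : ℝ) ≤ 1 - ε / 2) hcont
    (⟨hneg, by simpa using (Real.exp_pos _).le⟩ : (0 : ℝ) ∈ Set.Icc _ _)
  exact ⟨q, ⟨hq.1, by linarith [hq.2]⟩, by linarith [hq.2], (sub_eq_zero.mp hroot).symm⟩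

lemma log_one_sub_le {s : ℝ} (h0 : 0 ≤ s) (h1 : s < 1) :
    Real.log (1 - s) ≤ -(s + s ^ 2 / 2) := by
  have h := sum_le_hasSum (Finset.range 2) (fun i _ => by positivity)
    (Real.hasSum_pow_div_log_of_abs_lt_one (by rwa [abs_of_nonneg h0]))
  norm_num [Finset.sum_range_succ] at h
  linarith

/-- Expansion of the Poisson Galton–Watson extinction probability near criticality:
there are `ε₀ > 0` and `M > 0` such that for every `ε ∈ (0, ε₀]`, the smallest root
`p_e(1+ε)` in `[0,1]` of `x = exp(-(1+ε)(1-x))` satisfies `|p_e - (1 - 2ε)| ≤ M ε²`. -/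
theorem extinction_probability_expansion :
    ∃ ε₀ M : ℝ, 0 < ε₀ ∧ 0 < M ∧ ∀ ε : ℝ, ε ∈ Set.Ioc 0 ε₀ →
      ∀ p : ℝ, p ∈ Set.Icc (0 : ℝ) 1 → p = Real.exp (-(1 + ε) * (1 - p)) →
        (∀ q : ℝ, q ∈ Set.Icc (0 : ℝ) 1 → q = Real.exp (-(1 + ε) * (1 - q)) → p ≤ q) →
        |p - (1 - 2 * ε)| ≤ M * ε ^ 2 := by
  refine ⟨1 / 4, 16, by norm_num, by norm_num, ?_⟩
  rintro ε ⟨h0, h1⟩ p - hp hmin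
  obtain ⟨q, hq, hq1, hroot⟩ := exists_root_lt_one h0 h1
  have hp1 : p < 1 := (hmin q hq hroot).trans_lt hq1
  have hp0 : 0 < p := hp ▸ Real.exp_pos _
  have hlog : Real.log p = -(1 + ε) * (1 - p) := by
    conv_lhs => rw [hp]
    exact Real.log_exp _
  obtain ⟨s, rfl⟩ : ∃ s, p = 1 - s := ⟨1 - p, by ring⟩
  rw [sub_sub_cancel] at hlog
  have hs0 : 0 < s := by linarith
  have hs1 : s < 1 := by linarith
  have hs2 : s ≤ 2 * ε := by
    have h := log_one_sub_le hs0.le hs1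
    rw [hlog] at h
    nlinarith
  have hcubic := Real.abs_log_sub_add_sum_range_le (by rwa [abs_of_pos hs0]) 2
  norm_num [Finset.sum_range_succ] at hcubic
  rw [hlog, abs_of_pos hs0] at hcubic
  have hdiv : s ^ 3 / (1 - s) ≤ 2 * s ^ 3 := by
    rw [div_le_iff₀ hp0]
    nlinarith [pow_pos hs0 3]
  have hlower : ε - s / 2 ≤ 2 * s ^ 2 := by
    have h := (abs_le.mp (hcubic.trans hdiv)).1
    refine le_of_mul_le_mul_left ?_ hs0
    nlinarith
  rw [abs_le]
  constructor <;> nlinarith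

end Paper
end
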